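/- arXiv:2209.05338 — 5 statements merged into one kernel-verified Lean document; each statement's English description precedes it below -/
import Mathlib

section
/- Fix θ ∈ (0, π/2] and set a = (cos(θ/2), sin(θ/2), 0), b = (cos(θ/2), -sin(θ/2), 0) in ℝ³. Let ε(+a) = (1/8)(I + a·σ), ε(−a) = (1/8)(I − a·σ), ε(+b) = (1/8)(I + b·σ), ε(−b) = (1/8)(I − b·σ). For every 4-outcome POVM M indexed by X = {+a,−a,+b,−b}, i.e., each M(x) is a positive semidefinite 2×2 complex matrix and Σ_{x∈X} M(x) = I, the discrimination success probability satisfies Σ_{x∈X} tr(ε(x) M(x)) ≤ 1/2. Moreover, the standard measurement M^st given by M^st(±a) = (1/4)(I ± a·σ), M^st(±b) = (1/4)(I ± b·σ) is a POVM attaining Σ_{x∈X} tr(ε(x) M^st(x)) = 1/2. -/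
open Matrix
open scoped ComplexOrder

/-- For `v = (v₁, v₂, v₃) ∈ ℝ³`, the matrix `v·σ = v₁σ₁ + v₂σ₂ + v₃σ₃` where
`σ₁, σ₂, σ₃` are the Pauli matrices. -/
noncomputable def pauli (v : Fin 3 → ℝ) : Matrix (Fin 2) (Fin 2) ℂ :=
  (v 0 : ℂ) • !![0, 1; 1, 0] + (v 1 : ℂ) • !![0, -Complex.I; Complex.I, 0] +
    (v 2 : ℂ) • !![1, 0; 0, -1]

/-- The Bloch vector `a = (cos(θ/2), sin(θ/2), 0)`. -/
noncomputable def aVec (θ : ℝ) : Fin 3 → ℝ := ![Real.cos (θ/2), Real.sin (θ/2), 0]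

/-- The Bloch vector `b = (cos(θ/2), -sin(θ/2), 0)`. -/
noncomputable def bVec (θ : ℝ) : Fin 3 → ℝ := ![Real.cos (θ/2), -Real.sin (θ/2), 0]

/-- The four inputs `X = {+a, -a, +b, -b}`, indexed as `0 ↦ +a`, `1 ↦ -a`, `2 ↦ +b`,
`3 ↦ -b`. -/
noncomputable def vecX (θ : ℝ) : Fin 4 → Fin 3 → ℝ := ![aVec θ, -aVec θ, bVec θ, -bVec θ]

/-- The state ensemble `ε(±a) = (1/8)(I ± a·σ)`, `ε(±b) = (1/8)(I ± b·σ)`. -/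
noncomputable def eps (θ : ℝ) (x : Fin 4) : Matrix (Fin 2) (Fin 2) ℂ :=
  (1/8 : ℂ) • (1 + pauli (vecX θ x))

/-- The standard measurement `M^st(±a) = (1/4)(I ± a·σ)`, `M^st(±b) = (1/4)(I ± b·σ)`. -/
noncomputable def Mst (θ : ℝ) (z : Fin 4) : Matrix (Fin 2) (Fin 2) ℂ :=
  (1/4 : ℂ) • (1 + pauli (vecX θ z))

lemma pauli_neg (v : Fin 3 → ℝ) : pauli (-v) = -pauli v := by
  simp only [pauli, Pi.neg_apply, Complex.ofReal_neg, neg_smul]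
  abel

lemma pauli_isHermitian (v : Fin 3 → ℝ) : (pauli v).IsHermitian := by
  ext i j
  fin_cases i <;> fin_cases j <;> simp [pauli]

lemma pauli_mul_self {v : Fin 3 → ℝ} (hv : v 0 ^ 2 + v 1 ^ 2 + v 2 ^ 2 = 1) :
    pauli v * pauli v = 1 := by
  have h : (v 0 : ℂ) ^ 2 + (v 1 : ℂ) ^ 2 + (v 2 : ℂ) ^ 2 = 1 := by exact_mod_cast hv
  ext i j
  fin_cases i <;> fin_cases j <;> simp [pauli, Matrix.mul_apply, Fin.sum_univ_two]
  · linear_combination h - (v 1 : ℂ) ^ 2 * Complex.I_sq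
  · ring
  · ring
  · linear_combination h - (v 1 : ℂ) ^ 2 * Complex.I_sq

lemma one_add_pauli_isHermitian (v : Fin 3 → ℝ) : (1 + pauli v).IsHermitian :=
  isHermitian_one.add (pauli_isHermitian v)

lemma one_add_pauli_mul_self {v : Fin 3 → ℝ} (hv : v 0 ^ 2 + v 1 ^ 2 + v 2 ^ 2 = 1) :
    (1 + pauli v) * (1 + pauli v) = (2 : ℂ) • (1 + pauli v) := by
  rw [add_mul, mul_add, mul_add, pauli_mul_self hv, one_mul, mul_one, one_mul, two_smul]
  abel

lemma one_add_pauli_posSemidef {v : Fin 3 → ℝ} (hv : v 0 ^ 2 + v 1 ^ 2 + v 2 ^ 2 = 1) :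
    (1 + pauli v).PosSemidef := by
  have h := posSemidef_conjTranspose_mul_self (1 + pauli v)
  rw [(one_add_pauli_isHermitian v).eq, one_add_pauli_mul_self hv] at h
  have h2 := h.smul (show (0 : ℂ) ≤ 1 / 2 by positivity)
  rwa [smul_smul, show (1 / 2 : ℂ) * 2 = 1 by norm_num, one_smul] at h2

lemma trace_one_add_pauli_mul_nonneg {v : Fin 3 → ℝ} (hv : v 0 ^ 2 + v 1 ^ 2 + v 2 ^ 2 = 1)
    {M : Matrix (Fin 2) (Fin 2) ℂ} (hM : M.PosSemidef) :
    0 ≤ ((1 + pauli v) * M).trace := by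
  have h := (hM.mul_mul_conjTranspose_same (1 + pauli v)).trace_nonneg
  rw [(one_add_pauli_isHermitian v).eq, trace_mul_comm, ← mul_assoc, one_add_pauli_mul_self hv,
    smul_mul_assoc, trace_smul, smul_eq_mul] at h
  have h2 := mul_nonneg (show (0 : ℂ) ≤ 1 / 2 by positivity) h
  rwa [← mul_assoc, show (1 / 2 : ℂ) * 2 = 1 by norm_num, one_mul] at h2

lemma vecX_norm_sq (θ : ℝ) (x : Fin 4) :
    vecX θ x 0 ^ 2 + vecX θ x 1 ^ 2 + vecX θ x 2 ^ 2 = 1 := by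
  fin_cases x <;> simp [vecX, aVec, bVec]

lemma trace_eps_mul_le (θ : ℝ) (x : Fin 4) {M : Matrix (Fin 2) (Fin 2) ℂ}
    (hM : M.PosSemidef) : (eps θ x * M).trace ≤ (1 / 4 : ℂ) * M.trace := by
  have hv : (-vecX θ x) 0 ^ 2 + (-vecX θ x) 1 ^ 2 + (-vecX θ x) 2 ^ 2 = 1 := by
    simpa using vecX_norm_sq θ x
  have h := mul_nonneg (show (0 : ℂ) ≤ 1 / 8 by positivity) (trace_one_add_pauli_mul_nonneg hv hM)
  rw [← sub_nonneg]
  convert h using 1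
  simp only [eps, pauli_neg, add_mul, neg_mul, one_mul, smul_mul_assoc, trace_smul, trace_add,
    trace_neg, smul_eq_mul]
  ring

lemma trace_eps_mul_Mst (θ : ℝ) (x : Fin 4) : (eps θ x * Mst θ x).trace = 1 / 8 := by
  have h : (pauli (vecX θ x)).trace = 0 := by simp [pauli, trace_fin_two]
  rw [eps, Mst, smul_mul_smul_comm, one_add_pauli_mul_self (vecX_norm_sq θ x)]
  simp only [trace_smul, trace_add, trace_one, h, smul_eq_mul, Fintype.card_fin]
  norm_num

lemma sum_Mst (θ : ℝ) : ∑ z : Fin 4, Mst θ z = 1 := by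
  simp only [Fin.sum_univ_four, Mst, vecX, cons_val, pauli_neg]
  module

theorem standard_measurement_optimal_no_cpost (θ : ℝ) (hθ : θ ∈ Set.Ioc 0 (Real.pi / 2)) :
    (∀ M : Fin 4 → Matrix (Fin 2) (Fin 2) ℂ,
      (∀ x, (M x).PosSemidef) → (∑ x : Fin 4, M x) = 1 →
      (∑ x : Fin 4, (eps θ x * M x).trace) ≤ (1/2 : ℂ)) ∧
    (∀ z, (Mst θ z).PosSemidef) ∧ (∑ z : Fin 4, Mst θ z) = 1 ∧
    (∑ x : Fin 4, (eps θ x * Mst θ x).trace) = (1/2 : ℂ) := by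
  refine ⟨fun M hM hsum => ?_, fun z => ?_, sum_Mst θ, ?_⟩
  · calc ∑ x, (eps θ x * M x).trace ≤ ∑ x, (1 / 4 : ℂ) * (M x).trace :=
          Finset.sum_le_sum fun x _ => trace_eps_mul_le θ x (hM x)
      _ = 1 / 2 := by
          rw [← Finset.mul_sum, ← trace_sum, hsum, trace_one, Fintype.card_fin]
          norm_num
  · exact (one_add_pauli_posSemidef (vecX_norm_sq θ z)).smul (by positivity)
  · simp only [trace_eps_mul_Mst, Finset.sum_const, Finset.card_univ, Fintype.card_fin]
    norm_num
end

section
/- Fix θ ∈ (0, π/2] and set a = (cos(θ/2), sin(θ/2), 0), b = (cos(θ/2), -sin(θ/2), 0) in ℝ³; X = {+a,−a,+b,−b}; ε(±a) = (1/8)(I ± a·σ), ε(±b) = (1/8)(I ± b·σ). Let m = (a+3b)/√(10+6cos θ), n = (3a+b)/√(10+6cos θ) and M^an(±m) = (1/4)(I ± m·σ), M^an(±n) = (1/4)(I ± n·σ), with outcome set Z = {+m,−m,+n,−n}. Define priority lists: outcome +n ↦ (+a,+b,−b,−a); −n ↦ (−a,−b,+b,+a); +m ↦ (+b,+a,−a,−b);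 −m ↦ (−b,−a,+a,+b), and for an excluded set S ⊂ X let g(z,S) be the first element of the priority list of outcome z not belonging to S. Then the success probability with one excluded wrong answer, E₁ = Σ_{x∈X} (1/3) Σ_{t∈X, t≠x} Σ_{z∈Z} tr(ε(x) M^an(z)) · [g(z,{t}) = x], equals (4 + √(10+6cos θ))/12. -/
open Matrix

/-- The relabeling priority lists (in the indexing `0 ↦ +a`, `1 ↦ -a`, `2 ↦ +b`, `3 ↦ -b`):
outcome `+a ↦ (+a, +b, -b, -a)`, `-a ↦ (-a, -b, +b, +a)`, `+b ↦ (+b, +a, -a, -b)`,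
`-b ↦ (-b, -a, +a, +b)`. -/
def prio : Fin 4 → List (Fin 4) := ![[0, 2, 3, 1], [1, 3, 2, 0], [2, 0, 1, 3], [3, 1, 0, 2]]

/-- `guess z S` is the first element of the priority list of outcome `z` not belonging to
the excluded set `S`. -/
def guess (z : Fin 4) (S : Finset (Fin 4)) : Fin 4 :=
  ((prio z).filter (fun y => decide (y ∉ S))).headI

/-- The Bloch vector `m = (a + 3b)/√(10 + 6 cos θ)`. -/
noncomputable def mVec (θ : ℝ) : Fin 3 → ℝ :=
  (Real.sqrt (10 + 6 * Real.cos θ))⁻¹ • (aVec θ + (3 : ℝ) • bVec θ)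

/-- The Bloch vector `n = (3a + b)/√(10 + 6 cos θ)`. -/
noncomputable def nVec (θ : ℝ) : Fin 3 → ℝ :=
  (Real.sqrt (10 + 6 * Real.cos θ))⁻¹ • ((3 : ℝ) • aVec θ + bVec θ)

/-- The outcome set `Z = {+n, -n, +m, -m}` of the anticipative measurement, indexed
consistently with the priority lists: `0 ↦ +n`, `1 ↦ -n`, `2 ↦ +m`, `3 ↦ -m`. -/
noncomputable def vecZ (θ : ℝ) : Fin 4 → Fin 3 → ℝ := ![nVec θ, -nVec θ, mVec θ, -mVec θ]

/-- The anticipative measurement `M^an(±m) = (1/4)(I ± m·σ)`, `M^an(±n) = (1/4)(I ± n·σ)`. -/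
noncomputable def Man (θ : ℝ) (z : Fin 4) : Matrix (Fin 2) (Fin 2) ℂ :=
  (1/4 : ℂ) • (1 + pauli (vecZ θ z))

theorem trace_one_add_pauli_mul (u v : Fin 3 → ℝ) :
    ((1 + pauli u) * (1 + pauli v)).trace = ((2 * (1 + u ⬝ᵥ v) : ℝ) : ℂ) := by
  simp [pauli, Matrix.trace_fin_two, Matrix.one_fin_two, Fin.sum_univ_succ, dotProduct]
  linear_combination (-2 * (u 1 : ℂ) * v 1) * Complex.I_sq

theorem trace_eps_mul_Man (θ : ℝ) (x z : Fin 4) :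
    (eps θ x * Man θ z).trace = (((1 + vecX θ x ⬝ᵥ vecZ θ z) / 16 : ℝ) : ℂ) := by
  rw [eps, Man, smul_mul_smul_comm, Matrix.trace_smul, trace_one_add_pauli_mul]
  push_cast [smul_eq_mul]
  ring

/-- The number of single exclusions `t ≠ x` after which outcome `z` leads to the guess `x`. -/
def guessCount : Matrix (Fin 4) (Fin 4) ℕ :=
  !![3, 0, 1, 0; 0, 3, 0, 1; 1, 0, 3, 0; 0, 1, 0, 3]

theorem card_guess_singleton_eq (x z : Fin 4) :
    ((Finset.univ.erase x).filter (fun t => guess z {t} = x)).card =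
      guessCount x z := by
  fin_cases x <;> fin_cases z <;> rfl

theorem sixteen_mul_cos_half_sq_add_four_mul_sin_half_sq (θ : ℝ) :
    16 * Real.cos (θ / 2) ^ 2 + 4 * Real.sin (θ / 2) ^ 2 = 10 + 6 * Real.cos θ := by
  have h := Real.cos_sq (θ / 2)
  rw [mul_div_cancel₀ θ two_ne_zero] at h
  rw [Real.sin_sq, h]
  ring

theorem anticipative_measurement_one_exclusion (θ : ℝ) (hθ : θ ∈ Set.Ioc 0 (Real.pi / 2)) :
    (∑ x : Fin 4, (1/3 : ℂ) * ∑ t ∈ Finset.univ.erase x, ∑ z : Fin 4,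
        (eps θ x * Man θ z).trace * (if guess z {t} = x then 1 else 0)) =
      (((4 + Real.sqrt (10 + 6 * Real.cos θ)) / 12 : ℝ) : ℂ) := by
  have key : ∀ x : Fin 4, (∑ t ∈ Finset.univ.erase x, ∑ z : Fin 4,
      (eps θ x * Man θ z).trace * (if guess z {t} = x then 1 else 0)) =
      ∑ z : Fin 4, (eps θ x * Man θ z).trace *
        (guessCount x z : ℂ) := by
    intro x
    rw [Finset.sum_comm]
    refine Finset.sum_congr rfl fun z _ => ?_
    rw [← Finset.mul_sum, Finset.sum_boole, card_guess_singleton_eq]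
  simp_rw [key, trace_eps_mul_Man]
  have hpos : 0 < 10 + 6 * Real.cos θ := by linarith [Real.neg_one_le_cos θ]
  have hR := Real.sq_sqrt hpos.le
  have hR0 := (Real.sqrt_pos.2 hpos).ne'
  have hcs := sixteen_mul_cos_half_sq_add_four_mul_sin_half_sq θ
  have hreal : ∑ x : Fin 4, (1 / 3 : ℝ) * ∑ z : Fin 4, (1 + vecX θ x ⬝ᵥ vecZ θ z) / 16 *
      (guessCount x z : ℝ) =
      (4 + Real.sqrt (10 + 6 * Real.cos θ)) / 12 := by
    simp [Fin.sum_univ_succ, vecX, vecZ, aVec, bVec, mVec, nVec, dotProduct, guessCount]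
    generalize Real.sqrt (10 + 6 * Real.cos θ) = R at *
    field_simp
    linear_combination 48 * hcs - 48 * hR
  rw [← hreal]
  push_cast
  rfl
end

section
/- For every θ ∈ (0, π/2], the success probability of the anticipative measurement with one excluded wrong answer is at least that of the standard measurement: (4 + √(10+6cos θ))/12 ≥ (3 + cos²(θ/2))/6, with strict inequality for θ ∈ (0, π/2]. -/
theorem anticipative_beats_standard_one_exclusion (θ : ℝ)
    (hθ : θ ∈ Set.Ioc 0 (Real.pi / 2)) :
    (4 + Real.sqrt (10 + 6 * Real.cos θ)) / 12 ≥ (3 + Real.cos (θ/2) ^ 2) / 6 ∧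
    (4 + Real.sqrt (10 + 6 * Real.cos θ)) / 12 > (3 + Real.cos (θ/2) ^ 2) / 6 := by
  obtain ⟨hpos, hle⟩ := hθ
  have hc0 : 0 ≤ Real.cos θ := Real.cos_nonneg_of_mem_Icc ⟨by linarith, hle⟩
  have hc1 : Real.cos θ < 1 := by
    simpa using Real.cos_lt_cos_of_nonneg_of_le_pi_div_two le_rfl hle hpos
  have half : Real.cos (θ / 2) ^ 2 = (1 + Real.cos θ) / 2 := by
    rw [Real.cos_sq, mul_div_cancel₀ θ two_ne_zero]
    ring
  have key : 3 + Real.cos θ < Real.sqrt (10 + 6 * Real.cos θ) :=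
    Real.lt_sqrt_of_sq_lt (by nlinarith)
  rw [half]
  constructor <;> linarith
end

section
/- For every θ ∈ (0, π/2], the success probability of the anticipative measurement with two excluded wrong answers is at least that of the standard measurement: (6 + √(10+6cos θ))/12 ≥ (4 + cos²(θ/2))/6, with strict inequality for θ ∈ (0, π/2]. -/
theorem anticipative_beats_standard_two_exclusions (θ : ℝ)
    (hθ : θ ∈ Set.Ioc 0 (Real.pi / 2)) :
    (6 + Real.sqrt (10 + 6 * Real.cos θ)) / 12 ≥ (4 + Real.cos (θ/2) ^ 2) / 6 ∧
    (6 + Real.sqrt (10 + 6 * Real.cos θ)) / 12 > (4 + Real.cos (θ/2) ^ 2) / 6 := by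
  obtain ⟨hpos, hle⟩ := hθ
  have hcos_nonneg : 0 ≤ Real.cos θ :=
    Real.cos_nonneg_of_mem_Icc ⟨by linarith, hle⟩
  have hcos_lt : Real.cos θ < 1 := by
    simpa using Real.cos_lt_cos_of_nonneg_of_le_pi_div_two le_rfl hle hpos
  have hhalf : Real.cos (θ/2) ^ 2 = 1 / 2 + Real.cos θ / 2 := by
    rw [Real.cos_sq, mul_div_cancel₀ θ two_ne_zero]
  have hsqrt : 3 + Real.cos θ < Real.sqrt (10 + 6 * Real.cos θ) :=
    Real.lt_sqrt_of_sq_lt (by nlinarith)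
  have hlt : (6 + Real.sqrt (10 + 6 * Real.cos θ)) / 12 > (4 + Real.cos (θ/2) ^ 2) / 6 := by
    rw [hhalf]
    linarith
  exact ⟨hlt.le, hlt⟩
end

section
/- Let c ∈ [0,1] be a real number. Over all integers α₊, α₋, β₊, β₋ with 0 ≤ α₊, α₋, β₊, β₋ ≤ 3 and α₊ + α₋ + β₊ + β₋ ≤ 4, the maximum of γ(α₊, α₋, β₊, β₋) = α₊ + α₋ + β₊ + β₋ + √((α₊ − α₋)² + (β₊ − β₋)² + 2(α₊ − α₋)(β₊ − β₋)·c) equals 4 + √(10 + 6c), and it is attained at (α₊, α₋, β₊, β₋) = (3, 0, 1, 0). -/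
/-- The objective function `γ(α₊, α₋, β₊, β₋)` of the constrained integer optimization
arising in the optimality proof of the anticipative measurement. -/
noncomputable def gam (c : ℝ) (ap am bp bm : ℤ) : ℝ :=
  ((ap + am + bp + bm : ℤ) : ℝ) +
    Real.sqrt ((((ap - am) ^ 2 + (bp - bm) ^ 2 : ℤ) : ℝ) +
      2 * (((ap - am) * (bp - bm) : ℤ) : ℝ) * c)

/-- On the octagon `|x|, |y| ≤ 3`, `|x| + |y| ≤ 4`, the form `x² + y² + 2xyc` is at most
`10 + 6c`: it interpolates affinely between `x² + y² ≤ 10` and `(x + y)² ≤ 16`. -/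
theorem sq_add_sq_add_two_mul_le {c : ℝ} (hc0 : 0 ≤ c) (hc1 : c ≤ 1) {x y : ℤ}
    (hx : |x| ≤ 3) (hy : |y| ≤ 3) (hxy : |x| + |y| ≤ 4) :
    ((x ^ 2 + y ^ 2 : ℤ) : ℝ) + 2 * ((x * y : ℤ) : ℝ) * c ≤ 10 + 6 * c := by
  have h0 : x ^ 2 + y ^ 2 ≤ 10 := by
    rw [← sq_abs x, ← sq_abs y]
    nlinarith [abs_nonneg x, abs_nonneg y,
      mul_nonneg (sub_nonneg.2 hx) (sub_nonneg.2 hy)]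
  have h1 : (x + y) ^ 2 ≤ 16 := by
    have := abs_le.1 ((abs_add_le x y).trans hxy)
    nlinarith
  have h0' : (x : ℝ) ^ 2 + (y : ℝ) ^ 2 ≤ 10 := by exact_mod_cast h0
  have h1' : ((x : ℝ) + y) ^ 2 ≤ 16 := by exact_mod_cast h1
  push_cast
  nlinarith [mul_le_mul_of_nonneg_left h0' (sub_nonneg.2 hc1),
    mul_le_mul_of_nonneg_left h1' hc0]

theorem constrained_max_k_one (c : ℝ) (hc0 : 0 ≤ c) (hc1 : c ≤ 1) :
    IsGreatest {y : ℝ | ∃ ap am bp bm : ℤ,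
        0 ≤ ap ∧ ap ≤ 3 ∧ 0 ≤ am ∧ am ≤ 3 ∧ 0 ≤ bp ∧ bp ≤ 3 ∧ 0 ≤ bm ∧ bm ≤ 3 ∧
        ap + am + bp + bm ≤ 4 ∧ y = gam c ap am bp bm}
      (4 + Real.sqrt (10 + 6 * c)) ∧
    gam c 3 0 1 0 = 4 + Real.sqrt (10 + 6 * c) := by
  have hval : gam c 3 0 1 0 = 4 + Real.sqrt (10 + 6 * c) := by
    norm_num [gam]
  refine ⟨⟨⟨3, 0, 1, 0, by norm_num [hval]⟩, ?_⟩, hval⟩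
  rintro _ ⟨ap, am, bp, bm, h1, h2, h3, h4, h5, h6, h7, h8, hsum, rfl⟩
  have hx : |ap - am| ≤ 3 := by rw [abs_le]; omega
  have hy : |bp - bm| ≤ 3 := by rw [abs_le]; omega
  have hxy : |ap - am| + |bp - bm| ≤ 4 := by grind
  refine add_le_add ?_ (Real.sqrt_le_sqrt (sq_add_sq_add_two_mul_le hc0 hc1 hx hy hxy))
  exact_mod_cast hsum
end
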